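/- Let 0 < η₁ < η₂, define ξ(α) = (α² + η₁²)/2 + (α² − η₁²)·K(η₁/α)/E(η₁/α) for α ∈ (η₁, η₂], and set ξ_crit^{(1)} = ξ(η₂) = (η₁² + η₂²)/2 + (η₂² − η₁²)·K(η₁/η₂)/E(η₁/η₂). Then for every ξ⋆ with η₁² < ξ⋆ < ξ_crit^{(1)}, there exists exactly one α₁ ∈ (η₁, η₂) such that ξ(α₁) = ξ⋆. -/

import Mathlib

open Real

/-- The complete elliptic integral of the first kind,
`K(m) = ∫₀^{π/2} dθ/√(1 − m² sin²θ)`. -/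
noncomputable def ellipticK (m : ℝ) : ℝ :=
  ∫ θ in (0:ℝ)..(π / 2), 1 / Real.sqrt (1 - m ^ 2 * Real.sin θ ^ 2)

/-- The complete elliptic integral of the second kind,
`E(m) = ∫₀^{π/2} √(1 − m² sin²θ) dθ`. -/
noncomputable def ellipticE (m : ℝ) : ℝ :=
  ∫ θ in (0:ℝ)..(π / 2), Real.sqrt (1 - m ^ 2 * Real.sin θ ^ 2)

open Set Filter Topology

lemma one_sub_sq_pos_of_abs_lt_one {m : ℝ} (hm : |m| < 1) : 0 < 1 - m ^ 2 :=
  sub_pos.2 ((sq_lt_one_iff_abs_lt_one m).2 hm)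

lemma one_sub_sq_le_one_sub_sq_mul_sin_sq (m θ : ℝ) :
    1 - m ^ 2 ≤ 1 - m ^ 2 * sin θ ^ 2 := by
  nlinarith [sq_nonneg m, sin_sq_le_one θ]

lemma one_sub_sq_mul_sin_sq_pos {m : ℝ} (hm : |m| < 1) (θ : ℝ) :
    0 < 1 - m ^ 2 * sin θ ^ 2 :=
  (one_sub_sq_pos_of_abs_lt_one hm).trans_le (one_sub_sq_le_one_sub_sq_mul_sin_sq m θ)

lemma continuous_ellipticE_integrand (m : ℝ) :
    Continuous fun θ => √(1 - m ^ 2 * sin θ ^ 2) := by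
  fun_prop

lemma continuous_ellipticK_integrand {m : ℝ} (hm : |m| < 1) :
    Continuous fun θ => 1 / √(1 - m ^ 2 * sin θ ^ 2) :=
  continuous_const.div (continuous_ellipticE_integrand m) fun θ =>
    (sqrt_pos.2 (one_sub_sq_mul_sin_sq_pos hm θ)).ne'

lemma ellipticK_nonneg (m : ℝ) : 0 ≤ ellipticK m :=
  intervalIntegral.integral_nonneg (by positivity) fun _ _ => by positivity

lemma one_le_ellipticE {m : ℝ} (hm : |m| < 1) : 1 ≤ ellipticE m := by
  have h : ∫ θ in (0:ℝ)..(π / 2), cos θ = 1 := by simp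
  rw [← h]
  refine intervalIntegral.integral_mono_on (by positivity)
    (continuous_cos.intervalIntegrable _ _)
    ((continuous_ellipticE_integrand m).intervalIntegrable _ _) fun θ _ => ?_
  apply le_sqrt_of_sq_le
  nlinarith [one_sub_sq_pos_of_abs_lt_one hm, sin_sq_add_cos_sq θ, sq_nonneg (sin θ)]

lemma sqrt_one_sub_sq_mul_ellipticK_le {m : ℝ} (hm : |m| < 1) :
    √(1 - m ^ 2) * ellipticK m ≤ π / 2 := by
  have h : ∫ _ in (0:ℝ)..(π / 2), (1 : ℝ) = π / 2 := by simp
  rw [← h, ellipticK, ← intervalIntegral.integral_const_mul]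
  refine intervalIntegral.integral_mono_on (by positivity)
    ((continuous_const.mul (continuous_ellipticK_integrand hm)).intervalIntegrable _ _)
    (continuous_const.intervalIntegrable _ _) fun θ _ => ?_
  rw [mul_one_div, div_le_one (sqrt_pos.2 (one_sub_sq_mul_sin_sq_pos hm θ))]
  exact sqrt_le_sqrt (one_sub_sq_le_one_sub_sq_mul_sin_sq m θ)

lemma one_sub_sq_mul_one_sub_sq_mul_sin_sq_le {m n : ℝ} (hm : 0 ≤ m) (hmn : m ≤ n) (θ : ℝ) :
    (1 - n ^ 2) * (1 - m ^ 2 * sin θ ^ 2) ≤ (1 - m ^ 2) * (1 - n ^ 2 * sin θ ^ 2) := by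
  have h : 0 ≤ (n ^ 2 - m ^ 2) * (1 - sin θ ^ 2) :=
    mul_nonneg (sub_nonneg.2 (by gcongr)) (sub_nonneg.2 (sin_sq_le_one θ))
  linarith

lemma sqrt_one_sub_sq_mul_ellipticK_anti {m n : ℝ} (hm : 0 ≤ m) (hmn : m ≤ n) (hn : n < 1) :
    √(1 - n ^ 2) * ellipticK n ≤ √(1 - m ^ 2) * ellipticK m := by
  have hm' : |m| < 1 := by rw [abs_of_nonneg hm]; linarith
  have hn' : |n| < 1 := by rw [abs_of_nonneg (hm.trans hmn)]; exact hn
  simp only [ellipticK, ← intervalIntegral.integral_const_mul]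
  refine intervalIntegral.integral_mono_on (by positivity)
    ((continuous_const.mul (continuous_ellipticK_integrand hn')).intervalIntegrable _ _)
    ((continuous_const.mul (continuous_ellipticK_integrand hm')).intervalIntegrable _ _)
    fun θ _ => ?_
  rw [mul_one_div, mul_one_div, div_le_div_iff₀
    (sqrt_pos.2 (one_sub_sq_mul_sin_sq_pos hn' θ)) (sqrt_pos.2 (one_sub_sq_mul_sin_sq_pos hm' θ)),
    ← sqrt_mul (one_sub_sq_pos_of_abs_lt_one hn').le,
    ← sqrt_mul (one_sub_sq_pos_of_abs_lt_one hm').le]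
  exact sqrt_le_sqrt (one_sub_sq_mul_one_sub_sq_mul_sin_sq_le hm hmn θ)

lemma sqrt_one_sub_sq_mul_ellipticE_le {m n : ℝ} (hm : 0 ≤ m) (hmn : m ≤ n) (hn : n < 1) :
    √(1 - n ^ 2) * ellipticE m ≤ √(1 - m ^ 2) * ellipticE n := by
  have hm' : |m| < 1 := by rw [abs_of_nonneg hm]; linarith
  have hn' : |n| < 1 := by rw [abs_of_nonneg (hm.trans hmn)]; exact hn
  simp only [ellipticE, ← intervalIntegral.integral_const_mul]
  refine intervalIntegral.integral_mono_on (by positivity)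
    ((continuous_const.mul (continuous_ellipticE_integrand m)).intervalIntegrable _ _)
    ((continuous_const.mul (continuous_ellipticE_integrand n)).intervalIntegrable _ _)
    fun θ _ => ?_
  rw [← sqrt_mul (one_sub_sq_pos_of_abs_lt_one hn').le,
    ← sqrt_mul (one_sub_sq_pos_of_abs_lt_one hm').le]
  exact sqrt_le_sqrt (one_sub_sq_mul_one_sub_sq_mul_sin_sq_le hm hmn θ)

lemma antitoneOn_one_sub_sq_mul_ellipticK_div_ellipticE :
    AntitoneOn (fun m => (1 - m ^ 2) * ellipticK m / ellipticE m) (Ico 0 1) := by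
  rintro m ⟨hm, hm1⟩ n ⟨hn, hn1⟩ hmn
  have hm' : |m| < 1 := by rwa [abs_of_nonneg hm]
  have hn' : |n| < 1 := by rwa [abs_of_nonneg hn]
  have hsm := mul_self_sqrt (one_sub_sq_pos_of_abs_lt_one hm').le
  have hsn := mul_self_sqrt (one_sub_sq_pos_of_abs_lt_one hn').le
  have hEm : 0 < ellipticE m := one_pos.trans_le (one_le_ellipticE hm')
  have hEn : 0 < ellipticE n := one_pos.trans_le (one_le_ellipticE hn')
  beta_reduce
  rw [div_le_div_iff₀ hEn hEm]
  calc (1 - n ^ 2) * ellipticK n * ellipticE m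
      = (√(1 - n ^ 2) * ellipticK n) * (√(1 - n ^ 2) * ellipticE m) := by
        rw [← hsn, sqrt_mul_self (sqrt_nonneg _)]; ring
    _ ≤ (√(1 - m ^ 2) * ellipticK m) * (√(1 - m ^ 2) * ellipticE n) :=
        mul_le_mul (sqrt_one_sub_sq_mul_ellipticK_anti hm hmn hn1)
          (sqrt_one_sub_sq_mul_ellipticE_le hm hmn hn1) (by positivity)
          (mul_nonneg (sqrt_nonneg _) (ellipticK_nonneg m))
    _ = (1 - m ^ 2) * ellipticK m * ellipticE n := by
        rw [← hsm, sqrt_mul_self (sqrt_nonneg _)]; ring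

lemma one_sub_sq_mul_ellipticK_div_ellipticE_le {m : ℝ} (hm : |m| < 1) :
    (1 - m ^ 2) * ellipticK m / ellipticE m ≤ √(1 - m ^ 2) * (π / 2) := by
  have hs := mul_self_sqrt (one_sub_sq_pos_of_abs_lt_one hm).le
  calc (1 - m ^ 2) * ellipticK m / ellipticE m
      ≤ (1 - m ^ 2) * ellipticK m :=
        div_le_self (mul_nonneg (one_sub_sq_pos_of_abs_lt_one hm).le (ellipticK_nonneg m))
          (one_le_ellipticE hm)
    _ = √(1 - m ^ 2) * (√(1 - m ^ 2) * ellipticK m) := by rw [← mul_assoc, hs]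
    _ ≤ √(1 - m ^ 2) * (π / 2) := by
        gcongr
        exact sqrt_one_sub_sq_mul_ellipticK_le hm

lemma continuous_ellipticE : Continuous ellipticE := by
  unfold ellipticE
  exact intervalIntegral.continuous_parametric_intervalIntegral_of_continuous' (by fun_prop) _ _

lemma continuousAt_ellipticK {m : ℝ} (hm : |m| < 1) : ContinuousAt ellipticK m := by
  obtain ⟨c, hmc, hc⟩ := exists_between hm
  have hc0 : 0 ≤ c := (abs_nonneg m).trans hmc.le
  have hpos : 0 < 1 - c ^ 2 :=
    one_sub_sq_pos_of_abs_lt_one (by rwa [abs_of_nonneg hc0])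
  have hcont : Continuous fun x : ℝ =>
      ∫ θ in (0:ℝ)..(π / 2), 1 / √(max (1 - c ^ 2) (1 - x ^ 2 * sin θ ^ 2)) := by
    refine intervalIntegral.continuous_parametric_intervalIntegral_of_continuous' ?_ _ _
    refine continuous_const.div (by fun_prop) fun p => ?_
    exact (sqrt_pos.2 (lt_max_of_lt_left hpos)).ne'
  refine hcont.continuousAt.congr ?_
  filter_upwards [continuous_abs.continuousAt.eventually_lt continuousAt_const hmc] with x hx
  refine intervalIntegral.integral_congr fun θ _ => ?_
  have hxc : x ^ 2 ≤ c ^ 2 := sq_le_sq.2 (by rw [abs_of_nonneg hc0]; exact hx.le)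
  rw [max_eq_right ((sub_le_sub_left hxc 1).trans (one_sub_sq_le_one_sub_sq_mul_sin_sq x θ))]

lemma abs_div_lt_one_of_lt {η α : ℝ} (h₀ : 0 < η) (h : η < α) : |η / α| < 1 := by
  rw [abs_of_pos (div_pos h₀ (h₀.trans h))]
  exact (div_lt_one (h₀.trans h)).2 h

/-- The right-hand side of the modulation relation, as a function of the moving endpoint `α`. -/
noncomputable def modulationXi (η α : ℝ) : ℝ :=
  (α ^ 2 + η ^ 2) / 2 + (α ^ 2 - η ^ 2) * ellipticK (η / α) / ellipticE (η / α)

lemma modulationXi_eq {η α : ℝ} (hα : α ≠ 0) :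
    modulationXi η α = (α ^ 2 + η ^ 2) / 2 +
      α ^ 2 * ((1 - (η / α) ^ 2) * ellipticK (η / α) / ellipticE (η / α)) := by
  have h : α ^ 2 - η ^ 2 = α ^ 2 * (1 - (η / α) ^ 2) := by field_simp
  rw [modulationXi, h]
  ring

lemma strictMonoOn_modulationXi {η : ℝ} (h₀ : 0 < η) :
    StrictMonoOn (modulationXi η) (Ioi η) := by
  intro α (hα : η < α) β (hβ : η < β) hαβ
  have hα0 := h₀.trans hα
  have hβ0 := h₀.trans hβ
  rw [modulationXi_eq hα0.ne', modulationXi_eq hβ0.ne']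
  have hsq : α ^ 2 < β ^ 2 := by gcongr
  have hanti := antitoneOn_one_sub_sq_mul_ellipticK_div_ellipticE
    (a := η / β) ⟨by positivity, (div_lt_one hβ0).2 hβ⟩
    (b := η / α) ⟨by positivity, (div_lt_one hα0).2 hα⟩ (by gcongr)
  have hnonneg : 0 ≤ (1 - (η / β) ^ 2) * ellipticK (η / β) / ellipticE (η / β) :=
    div_nonneg (mul_nonneg (one_sub_sq_pos_of_abs_lt_one (abs_div_lt_one_of_lt h₀ hβ)).le
      (ellipticK_nonneg _)) (zero_le_one.trans (one_le_ellipticE (abs_div_lt_one_of_lt h₀ hβ)))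
  have := mul_le_mul hsq.le hanti (div_nonneg (mul_nonneg
    (one_sub_sq_pos_of_abs_lt_one (abs_div_lt_one_of_lt h₀ hα)).le (ellipticK_nonneg _))
    (zero_le_one.trans (one_le_ellipticE (abs_div_lt_one_of_lt h₀ hα)))) (sq_nonneg β)
  beta_reduce at this
  linarith

lemma continuousOn_modulationXi {η : ℝ} (h₀ : 0 < η) :
    ContinuousOn (modulationXi η) (Ioi η) := by
  intro α (hα : η < α)
  have hdiv : ContinuousAt (fun x => η / x) α :=
    continuousAt_const.div continuousAt_id (h₀.trans hα).ne'
  have hK : ContinuousAt (fun x => ellipticK (η / x)) α :=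
    (continuousAt_ellipticK (abs_div_lt_one_of_lt h₀ hα)).comp hdiv
  have hE : ContinuousAt (fun x => ellipticE (η / x)) α :=
    continuous_ellipticE.continuousAt.comp hdiv
  have hE0 : ellipticE (η / α) ≠ 0 :=
    (one_pos.trans_le (one_le_ellipticE (abs_div_lt_one_of_lt h₀ hα))).ne'
  have hquad : ContinuousAt (fun x : ℝ => (x ^ 2 + η ^ 2) / 2) α := by fun_prop
  have hfac : ContinuousAt (fun x : ℝ => x ^ 2 - η ^ 2) α := by fun_prop
  exact (hquad.add ((hfac.mul hK).div hE hE0)).continuousWithinAt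

lemma eventually_modulationXi_lt {η ξ : ℝ} (h₀ : 0 < η) (hξ : η ^ 2 < ξ) :
    ∀ᶠ α in 𝓝[>] η, modulationXi η α < ξ := by
  have hcont : ContinuousAt (fun α : ℝ =>
      (α ^ 2 + η ^ 2) / 2 + α ^ 2 * (√(1 - (η / α) ^ 2) * (π / 2))) η := by
    have hdiv : ContinuousAt (fun x => η / x) η :=
      continuousAt_const.div continuousAt_id h₀.ne'
    fun_prop
  have hlt : (η ^ 2 + η ^ 2) / 2 + η ^ 2 * (√(1 - (η / η) ^ 2) * (π / 2)) < ξ := by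
    simpa [div_self h₀.ne'] using hξ
  filter_upwards [(hcont.eventually_lt continuousAt_const hlt).filter_mono nhdsWithin_le_nhds,
    self_mem_nhdsWithin] with α hα (hηα : η < α)
  refine lt_of_le_of_lt ?_ hα
  rw [modulationXi_eq (h₀.trans hηα).ne']
  gcongr
  exact one_sub_sq_mul_ellipticK_div_ellipticE_le (abs_div_lt_one_of_lt h₀ hηα)

/-- For `0 < η₁ < η₂` and any `ξ⋆` strictly between `η₁²` and
`ξ_crit^{(1)} = (η₁² + η₂²)/2 + (η₂² − η₁²) K(η₁/η₂)/E(η₁/η₂)`, there is exactly one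
`α₁ ∈ (η₁, η₂)` solving the modulation relation
`(α₁² + η₁²)/2 + (α₁² − η₁²) K(η₁/α₁)/E(η₁/α₁) = ξ⋆`. -/
theorem modulation_relation_exists_unique (η₁ η₂ : ℝ) (h₀ : 0 < η₁) (h₁ : η₁ < η₂)
    (ξstar : ℝ) (hlo : η₁ ^ 2 < ξstar)
    (hhi : ξstar < (η₁ ^ 2 + η₂ ^ 2) / 2
      + (η₂ ^ 2 - η₁ ^ 2) * ellipticK (η₁ / η₂) / ellipticE (η₁ / η₂)) :
    ∃! α₁ : ℝ, α₁ ∈ Set.Ioo η₁ η₂ ∧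
      (α₁ ^ 2 + η₁ ^ 2) / 2
        + (α₁ ^ 2 - η₁ ^ 2) * ellipticK (η₁ / α₁) / ellipticE (η₁ / α₁) = ξstar := by
  have hhi' : ξstar < modulationXi η₁ η₂ := by
    rwa [modulationXi, add_comm (η₂ ^ 2)]
  obtain ⟨a, ha, haη⟩ :=
    ((eventually_modulationXi_lt h₀ hlo).and (Ioo_mem_nhdsGT h₁)).exists
  obtain ⟨α, hα, hαξ⟩ := intermediate_value_Ioo haη.2.le
    ((continuousOn_modulationXi h₀).mono fun x hx => haη.1.trans_le hx.1) ⟨ha, hhi'⟩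
  refine ⟨α, ⟨⟨haη.1.trans hα.1, hα.2⟩, hαξ⟩, ?_⟩
  rintro β ⟨hβ, hβξ⟩
  exact (strictMonoOn_modulationXi h₀).injOn hβ.1 (haη.1.trans hα.1) (hβξ.trans hαξ.symm)
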